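/- Let Φ : ℍ → V be holomorphic and satisfy the weight-2 automorphy law for π. Then there exist a holomorphic function F : ℍ → V with F′ = Φ on ℍ and a map z : Γ → V such that F(γ·τ) = π(γ)(F(τ)) + z(γ) for all γ ∈ Γ and τ ∈ ℍ; moreover z satisfies the cocycle law z(γ₁γ₂) = z(γ₁) + π(γ₁)(z(γ₂)). In other words, every holomorphic weight-2 automorphic function is the derivative of an Eichler integral of weight 0 for π. -/

import Mathlib

open Matrix

/-- The upper half-plane, as a subset of `ℂ`. -/
def UH : Set ℂ := {z : ℂ | 0 < z.im}

/-- The Möbius action of `SL(2,ℝ)` on the upper half-plane. -/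
noncomputable def moebius (γ : Matrix.SpecialLinearGroup (Fin 2) ℝ) (τ : ℂ) : ℂ :=
  ((γ 0 0 : ℂ) * τ + (γ 0 1 : ℂ)) / ((γ 1 0 : ℂ) * τ + (γ 1 1 : ℂ))

/-- The automorphy factor `cτ + d`. -/
noncomputable def denom (γ : Matrix.SpecialLinearGroup (Fin 2) ℝ) (τ : ℂ) : ℂ :=
  (γ 1 0 : ℂ) * τ + (γ 1 1 : ℂ)

theorem convex_UH : Convex ℝ UH := convex_halfSpace_im_gt 0

theorem isOpen_UH : IsOpen UH := isOpen_lt continuous_const Complex.continuous_im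

theorem denom_ne_zero (γ : Matrix.SpecialLinearGroup (Fin 2) ℝ) {τ : ℂ} (hτ : τ ∈ UH) :
    denom γ τ ≠ 0 :=
  UpperHalfPlane.denom_ne_zero (γ : GL (Fin 2) ℝ) ⟨τ, hτ⟩

theorem moebius_eq_smul (γ : Matrix.SpecialLinearGroup (Fin 2) ℝ) (τ : UpperHalfPlane) :
    moebius γ τ = ↑(γ • τ) :=
  (UpperHalfPlane.coe_specialLinearGroup_apply γ τ).symm

theorem moebius_mem_UH (γ : Matrix.SpecialLinearGroup (Fin 2) ℝ) {τ : ℂ} (hτ : τ ∈ UH) :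
    moebius γ τ ∈ UH := by
  rw [moebius_eq_smul γ ⟨τ, hτ⟩]
  exact (γ • (⟨τ, hτ⟩ : UpperHalfPlane)).im_pos

theorem moebius_mul (γ₁ γ₂ : Matrix.SpecialLinearGroup (Fin 2) ℝ) {τ : ℂ} (hτ : τ ∈ UH) :
    moebius (γ₁ * γ₂) τ = moebius γ₁ (moebius γ₂ τ) := by
  rw [moebius_eq_smul _ ⟨τ, hτ⟩, moebius_eq_smul γ₂ ⟨τ, hτ⟩, moebius_eq_smul, mul_smul]

theorem hasDerivAt_moebius (γ : Matrix.SpecialLinearGroup (Fin 2) ℝ) {τ : ℂ} (hτ : τ ∈ UH) :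
    HasDerivAt (moebius γ) ((denom γ τ ^ 2)⁻¹) τ := by
  have affine (a b : ℂ) : HasDerivAt (fun w : ℂ ↦ a * w + b) a τ := by
    simpa using ((hasDerivAt_id τ).const_mul a).add_const b
  have hdet : (γ 0 0 : ℂ) * γ 1 1 - γ 0 1 * γ 1 0 = 1 := by
    exact_mod_cast (Matrix.det_fin_two γ.1).symm.trans γ.2
  refine ((affine (γ 0 0) (γ 0 1)).div (affine (γ 1 0) (γ 1 1))
    (denom_ne_zero γ hτ)).congr_deriv ?_
  rw [← one_div]
  congr 1
  linear_combination hdet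


/-- every holomorphic function `Φ : ℍ → V` satisfying the weight-2
automorphy law for `π` is the derivative of an Eichler integral of weight 0 for `π`:
there exist a holomorphic `F : ℍ → V` with `F′ = Φ` and a map `z : Γ → V` such that
`F(γ·τ) = π(γ)(F(τ)) + z(γ)` on `ℍ`, with `z` satisfying the cocycle law. -/
theorem weight_two_automorphic_has_eichler_primitive
    {V : Type*} [NormedAddCommGroup V] [NormedSpace ℂ V] [FiniteDimensional ℂ V]
    (Γ : Subgroup (Matrix.SpecialLinearGroup (Fin 2) ℝ))
    (π : Γ →* (V ≃ₗ[ℂ] V))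
    (Φ : ℂ → V)
    (hΦhol : DifferentiableOn ℂ Φ UH)
    (hauto : ∀ γ : Γ, ∀ τ ∈ UH,
      ((denom ↑γ τ) ^ 2)⁻¹ • Φ (moebius ↑γ τ) = π γ (Φ τ)) :
    ∃ (F : ℂ → V) (z : Γ → V),
      (∀ τ ∈ UH, HasDerivAt F (Φ τ) τ) ∧
      (∀ γ : Γ, ∀ τ ∈ UH, F (moebius ↑γ τ) = π γ (F τ) + z γ) ∧
      (∀ γ₁ γ₂ : Γ, z (γ₁ * γ₂) = z γ₁ + π γ₁ (z γ₂)) := by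
  obtain ⟨F, hF'⟩ := convex_UH.exists_forall_hasDerivWithinAt hΦhol
  have hF : ∀ τ ∈ UH, HasDerivAt F (Φ τ) τ := fun τ hτ ↦
    (hF' τ hτ).hasDerivAt (isOpen_UH.mem_nhds hτ)
  have hI : Complex.I ∈ UH := by simp [UH]
  have hderiv (γ : Γ) (τ : ℂ) (hτ : τ ∈ UH) :
      HasDerivAt (fun w ↦ F (moebius γ w) - π γ (F w)) 0 τ := by
    have hleft := (hF _ (moebius_mem_UH γ hτ)).scomp τ (hasDerivAt_moebius γ hτ)
    have hright := (π γ).toLinearMap.toContinuousLinearMap.hasFDerivAt.comp_hasDerivAt τ (hF τ hτ)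
    refine (hleft.sub hright).congr_deriv ?_
    rw [hauto γ τ hτ]
    exact sub_self _
  have hshift (γ : Γ) : ∀ τ ∈ UH,
      F (moebius γ τ) = π γ (F τ) + (F (moebius γ Complex.I) - π γ (F Complex.I)) := by
    intro τ hτ
    rw [← sub_eq_iff_eq_add']
    exact isOpen_UH.is_const_of_deriv_eq_zero convex_UH.isPreconnected
      (fun w hw ↦ (hderiv γ w hw).differentiableAt.differentiableWithinAt)
      (fun w hw ↦ (hderiv γ w hw).deriv) hτ hI
  refine ⟨F, fun γ ↦ F (moebius γ Complex.I) - π γ (F Complex.I), hF, hshift, fun γ₁ γ₂ ↦ ?_⟩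
  beta_reduce
  rw [Subgroup.coe_mul, moebius_mul _ _ hI, hshift γ₁ _ (moebius_mem_UH γ₂ hI), map_mul,
    LinearEquiv.mul_apply, map_sub]
  abel
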